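/- Let G be a finite group and let X be a G-module that is free as a ℤ-module. Then for every i ∈ ℤ, the cup-product pairing induces an isomorphism of abelian groups Ĥ^i(G, Hom_ℤ(X, ℤ)) ≅ Hom_ℤ(Ĥ^{-i}(G, X), Ĥ^0(G, ℤ)), sending a class x to the map (x∪−), where the cup product Ĥ^i(G, Hom_ℤ(X,ℤ)) ⊗ Ĥ^{-i}(G, X) → Ĥ^0(G, ℤ) is induced by the evaluation map Hom_ℤ(X,ℤ) ⊗_ℤ X → ℤ. -/

import Mathlib

/-!
This file sets up Tate cohomology of a finite group `G` (with coefficients in objects of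
`Rep ℤ G`), realized concretely in each degree `n ∈ ℤ` as
`Ĥ^n(G, M) = Ĥ⁰(G, Hom_ℤ(J n, M))`, where `J n` is the standard `n`-th syzygy of the
trivial module `ℤ` (the `n`-th tensor power of the augmentation ideal `I_G` for `n ≥ 0`,
and of its `ℤ`-linear dual for `n < 0`), and `Ĥ⁰` denotes invariants modulo norms.
Cup products are induced by the canonical comparison maps `J (i+j) ⟶ J i ⊗ J j`.
-/

open CategoryTheory MonoidalCategory TensorProduct

set_option linter.unusedSectionVars false
set_option maxHeartbeats 1000000

attribute [instance 0] AddCommGroup.toIntModule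

namespace Enc

variable {k : Type} [CommRing k] {G : Type} [Group G] [Fintype G]

/-! ### Degree-zero Tate cohomology: invariants modulo norms -/

section Aux
variable {V V₂ : Type} [AddCommGroup V] [Module k V] [AddCommGroup V₂] [Module k V₂]

/-- The norm map `v ↦ ∑_{g ∈ G} g • v` of a representation. -/
noncomputable def rnorm (ρ : Representation k G V) : V →ₗ[k] V := ∑ g : G, ρ g

lemma rnorm_mem_invariants (ρ : Representation k G V) (v : V) :
    rnorm ρ v ∈ ρ.invariants := by
  intro g
  show (ρ g) ((∑ h : G, ρ h) v) = _
  simp only [LinearMap.sum_apply, map_sum]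
  rw [Fintype.sum_equiv (Equiv.mulLeft g) _ (fun h => ρ h v) (fun h => by
    rw [← Module.End.mul_apply, ← map_mul]; rfl)]
  simp [rnorm]

/-- The norm map, viewed as landing in the invariants. -/
noncomputable def rnormRes (ρ : Representation k G V) : V →ₗ[k] ρ.invariants :=
  (rnorm ρ).codRestrict ρ.invariants (rnorm_mem_invariants ρ)

/-- The image of the norm map, inside the invariants. -/
noncomputable def rnormIm (ρ : Representation k G V) : Submodule k ρ.invariants :=
  LinearMap.range (rnormRes ρ)

/-- Degree-zero Tate cohomology of a representation: invariants modulo norms. -/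
noncomputable def tate0 (ρ : Representation k G V) : Type :=
  ρ.invariants ⧸ rnormIm ρ

noncomputable instance (ρ : Representation k G V) : AddCommGroup (tate0 ρ) :=
  inferInstanceAs (AddCommGroup (ρ.invariants ⧸ rnormIm ρ))

noncomputable instance (ρ : Representation k G V) : Module k (tate0 ρ) :=
  inferInstanceAs (Module k (ρ.invariants ⧸ rnormIm ρ))

/-- The Tate class of an invariant vector. -/
noncomputable def tate0mk {ρ : Representation k G V} (v : V) (hv : v ∈ ρ.invariants) :
    tate0 ρ := Submodule.Quotient.mk (⟨v, hv⟩ : ρ.invariants)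

lemma invariants_comp {ρ : Representation k G V} {σ : Representation k G V₂}
    (f : V →ₗ[k] V₂) (hf : ∀ (g : G) (v : V), f (ρ g v) = σ g (f v)) :
    ∀ x ∈ ρ.invariants, f x ∈ σ.invariants := by
  intro x hx g
  rw [← hf g x, hx g]

/-- Functoriality of degree-zero Tate cohomology along equivariant maps. -/
noncomputable def tate0map {ρ : Representation k G V} {σ : Representation k G V₂}
    (f : V →ₗ[k] V₂) (hf : ∀ (g : G) (v : V), f (ρ g v) = σ g (f v)) :
    tate0 ρ →ₗ[k] tate0 σ :=
  Submodule.mapQ (rnormIm ρ) (rnormIm σ) (f.restrict (invariants_comp f hf))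
    (by
      rintro ⟨x, hx⟩ ⟨y, hy⟩
      refine ⟨f y, ?_⟩
      apply Subtype.ext
      have hy' := congrArg Subtype.val hy
      show rnorm σ (f y) = _
      simp only [LinearMap.restrict_apply]
      have : rnorm σ (f y) = f (rnorm ρ y) := by
        simp only [rnorm, LinearMap.sum_apply, map_sum]
        exact Finset.sum_congr rfl fun g _ => (hf g y).symm
      rw [this]
      exact congrArg f hy')

end Aux

/-- Degree-zero Tate cohomology `Ĥ⁰(G, W) = W^G / N_G W` of an object of `Rep k G`. -/
noncomputable def H0T (W : Rep k G) : Type := tate0 W.ρ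

noncomputable instance (W : Rep k G) : AddCommGroup (H0T W) :=
  inferInstanceAs (AddCommGroup (tate0 W.ρ))

noncomputable instance (W : Rep k G) : Module k (H0T W) :=
  inferInstanceAs (Module k (tate0 W.ρ))

/-- Functoriality of `Ĥ⁰` along morphisms of representations. -/
noncomputable def H0Tmap {W W' : Rep k G} (ψ : W ⟶ W') : H0T W →ₗ[k] H0T W' :=
  tate0map ψ.hom (fun g v => Rep.hom_comm_apply ψ g v)

/-! ### The augmentation ideal and the syzygy modules `J n` -/

variable (G)

/-- The representation `k[H]` on `H →₀ k` induced by a `G`-action on `H`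
(`Representation.ofMulAction` of the older Mathlib, which now acts on `MonoidAlgebra k H`). -/
noncomputable def ofMulAction (k G H : Type) [CommSemiring k] [Monoid G] [MulAction G H] :
    Representation k G (H →₀ k) where
  toFun g := Finsupp.lmapDomain k k (g • ·)
  map_one' := by ext; simp
  map_mul' x y := by ext; simp [mul_smul]

/-- The augmentation map `ℤ[G] → ℤ`. -/
noncomputable def aug : (G →₀ ℤ) →ₗ[ℤ] ℤ :=
  Finsupp.linearCombination ℤ (fun _ : G => (1 : ℤ))

lemma aug_comm (g : G) (x : G →₀ ℤ) :
    aug G (ofMulAction ℤ G G g x) = aug G x := by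
  unfold aug
  simp [ofMulAction, Finsupp.linearCombination_apply]
  rw [Finsupp.sum_mapDomain_index] <;> simp

/-- The underlying `ℤ`-module of the augmentation ideal. -/
noncomputable abbrev IGcar : Type := LinearMap.ker (aug G)

/-- The representation of `G` on the augmentation ideal. -/
noncomputable def IGρ : Representation ℤ G (IGcar G) where
  toFun g := (ofMulAction ℤ G G g).restrict (p := LinearMap.ker (aug G))
    (q := LinearMap.ker (aug G)) (by
      intro x hx
      simp only [LinearMap.mem_ker] at hx ⊢
      rw [aug_comm]; exact hx)
  map_one' := by ext x; simp [LinearMap.restrict_apply]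
  map_mul' g h := by ext x; simp [LinearMap.restrict_apply, Module.End.mul_apply]

/-- The augmentation ideal `I_G` of `ℤ[G]`, as an object of `Rep ℤ G`. -/
noncomputable def IGrep : Rep ℤ G := Rep.of (IGρ G)

/-- `Hom_ℤ(X, A)` with the conjugation `G`-action, i.e. the internal hom in `Rep ℤ G`. -/
noncomputable abbrev hRep {G : Type} [Group G] (X A : Rep.{0} ℤ G) : Rep.{0} ℤ G :=
  (Rep.ihom X).obj A

/-- The `ℤ`-linear dual of the augmentation ideal, as an object of `Rep ℤ G`. -/
noncomputable def DIG : Rep ℤ G := hRep (IGrep G) (𝟙_ (Rep ℤ G))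

instance : Module.Finite ℤ (IGcar G) := by
  have : Module.Finite ℤ (G →₀ ℤ) :=
    Module.Finite.equiv (Finsupp.linearEquivFunOnFinite ℤ ℤ G).symm
  exact Module.Finite.of_injective (LinearMap.ker (aug G)).subtype Subtype.val_injective

instance : Module.Free ℤ (IGcar G) := by infer_instance

/-- Nonnegative tensor powers `I_G^{⊗ n}` (with `I_G^{⊗ 0} = ℤ`). -/
noncomputable def Jp : ℕ → Rep ℤ G
  | 0 => 𝟙_ (Rep ℤ G)
  | n + 1 => Jp n ⊗ IGrep G

/-- Tensor powers of the dual of the augmentation ideal. -/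
noncomputable def Jn : ℕ → Rep ℤ G
  | 0 => 𝟙_ (Rep ℤ G)
  | n + 1 => Jn n ⊗ DIG G

/-- The standard syzygy modules of the trivial representation `ℤ`, indexed by `ℤ`:
`J n = I_G^{⊗ n}` for `n ≥ 0`, and `J n = (I_G^∨)^{⊗ (-n)}` for `n < 0`. -/
noncomputable def J : ℤ → Rep ℤ G
  | .ofNat n => Jp G n
  | .negSucc n => Jn G (n + 1)

lemma J_ofNat (m : ℕ) : J G (m : ℤ) = Jp G m := rfl

lemma J_neg (m : ℕ) : J G (-(m : ℤ)) = Jn G m := by cases m <;> rfl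

/-- The element of `(I_G)^∨ ⊗ I_G` corresponding to the identity map. -/
noncomputable def preElt : Module.Dual ℤ (IGcar G) ⊗[ℤ] IGcar G :=
  (dualTensorHomEquiv ℤ (IGcar G) (IGcar G)).symm LinearMap.id

/-- The canonical element of `I_G ⊗ (I_G)^∨` corresponding to the identity map. -/
noncomputable def coevElt : (IGrep G ⊗ DIG G).V :=
  (TensorProduct.comm ℤ _ _) (preElt G)

lemma dualTensorHom_map {A : Type} [AddCommGroup A] [Module ℤ A] (p q : A →ₗ[ℤ] A)
    (D : Module.Dual ℤ A →ₗ[ℤ] Module.Dual ℤ A) (hD : ∀ f, D f = f ∘ₗ q)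
    (t : Module.Dual ℤ A ⊗[ℤ] A) :
    dualTensorHom ℤ A A (TensorProduct.map D p t) = p ∘ₗ (dualTensorHom ℤ A A t) ∘ₗ q := by
  induction t with
  | zero => simp
  | tmul f v =>
      ext w
      simp [hD]
  | add x y hx hy =>
      simp only [map_add, hx, hy, LinearMap.add_comp, LinearMap.comp_add]

lemma conj_dualTensor (g : G) (t : Module.Dual ℤ (IGcar G) ⊗[ℤ] IGcar G) :
    dualTensorHom ℤ _ _ (TensorProduct.map ((DIG G).ρ g) ((IGrep G).ρ g) t)
      = (IGrep G).ρ g ∘ₗ (dualTensorHom ℤ _ _ t) ∘ₗ (IGrep G).ρ g⁻¹ := by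
  exact dualTensorHom_map ((IGρ G) g) ((IGρ G) g⁻¹) ((DIG G).ρ g) (fun _ => rfl) t

lemma coevElt_invariant (g : G) :
    ((IGrep G ⊗ DIG G).ρ g) (coevElt G) = coevElt G := by
  show TensorProduct.map ((IGrep G).ρ g) ((DIG G).ρ g)
      ((TensorProduct.comm ℤ _ _) (preElt G)) = _
  refine (TensorProduct.map_comm _ _ _).trans ?_
  show (TensorProduct.comm ℤ _ _) (TensorProduct.map ((DIG G).ρ g) ((IGrep G).ρ g) (preElt G))
      = (TensorProduct.comm ℤ _ _) (preElt G)
  congr 1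
  apply (dualTensorHomEquiv ℤ (IGcar G) (IGcar G)).injective
  have h2 : dualTensorHom ℤ (IGcar G) (IGcar G) (preElt G) = LinearMap.id :=
    (dualTensorHomEquiv ℤ (IGcar G) (IGcar G)).apply_symm_apply LinearMap.id
  show dualTensorHom ℤ (IGcar G) (IGcar G)
      (TensorProduct.map ((DIG G).ρ g) ((IGrep G).ρ g) (preElt G))
    = dualTensorHom ℤ (IGcar G) (IGcar G) (preElt G)
  refine (conj_dualTensor G g (preElt G)).trans ?_
  show (IGrep G).ρ g ∘ₗ dualTensorHom ℤ (IGcar G) (IGcar G) (preElt G) ∘ₗ (IGrep G).ρ g⁻¹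
      = dualTensorHom ℤ (IGcar G) (IGcar G) (preElt G)
  rw [h2]
  apply LinearMap.ext
  intro v
  exact Representation.self_inv_apply (IGrep G).ρ g v

/-- The coevaluation `ℤ ⟶ I_G ⊗ I_G^∨`. -/
noncomputable def coev : 𝟙_ (Rep ℤ G) ⟶ IGrep G ⊗ DIG G := Rep.ofHom {
  toLinearMap := LinearMap.toSpanSingleton ℤ _ (coevElt G)
  isIntertwining' := by
    intro g
    apply LinearMap.ext
    intro z
    show LinearMap.toSpanSingleton ℤ _ (coevElt G) ((𝟙_ (Rep ℤ G)).ρ g z)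
        = ((IGrep G ⊗ DIG G).ρ g) (LinearMap.toSpanSingleton ℤ _ (coevElt G) z)
    have hz : ((𝟙_ (Rep ℤ G)).ρ g z) = z := rfl
    rw [hz]
    show z • coevElt G = ((IGrep G ⊗ DIG G).ρ g) (z • coevElt G)
    rw [map_smul, coevElt_invariant] }


variable {G}

/-- One-step comparison `J (n+1) ⟶ J n ⊗ I_G`. -/
noncomputable def sMap : ∀ n : ℤ, J G (n + 1) ⟶ J G n ⊗ IGrep G
  | .ofNat m => 𝟙 (Jp G m ⊗ IGrep G)
  | .negSucc 0 =>
      coev G ≫ (β_ (IGrep G) (DIG G)).hom ≫ ((λ_ (DIG G)).inv ▷ IGrep G)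
  | .negSucc (m+1) =>
      (ρ_ (Jn G (m+1))).inv ≫ (Jn G (m+1) ◁ (coev G ≫ (β_ (IGrep G) (DIG G)).hom))
        ≫ (α_ (Jn G (m+1)) (DIG G) (IGrep G)).inv

/-- One-step comparison `J (n-1) ⟶ J n ⊗ I_G^∨`. -/
noncomputable def tMap : ∀ n : ℤ, J G (n - 1) ⟶ J G n ⊗ DIG G
  | .ofNat 0 => 𝟙 (𝟙_ (Rep ℤ G) ⊗ DIG G)
  | .ofNat (m+1) =>
      eqToHom (congrArg (J G) (show (Int.ofNat (m+1)) - 1 = ((m:ℕ) : ℤ) by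
        rw [Int.ofNat_eq_coe]; push_cast; ring)) ≫
      (ρ_ (Jp G m)).inv ≫ (Jp G m ◁ coev G) ≫ (α_ (Jp G m) (IGrep G) (DIG G)).inv
  | .negSucc m => eqToHom (show J G (Int.negSucc m - 1) = J G (Int.negSucc m) ⊗ DIG G from rfl)

/-- Comparison maps `J (i + m) ⟶ J i ⊗ J m` for `m ≥ 0`. -/
noncomputable def μpos (i : ℤ) : ∀ m : ℕ, J G (i + m) ⟶ J G i ⊗ J G (m : ℤ)
  | 0 => eqToHom (congrArg (J G) (by omega)) ≫ (ρ_ (J G i)).inv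
  | m + 1 =>
      eqToHom (congrArg (J G) (show i + ((m:ℕ)+1:ℕ) = (i + m) + 1 by omega))
        ≫ sMap (i + m) ≫ (μpos i m ▷ IGrep G) ≫ (α_ (J G i) (J G (m:ℤ)) (IGrep G)).hom

/-- Comparison maps `J (i - m) ⟶ J i ⊗ J (-m)` for `m ≥ 0`. -/
noncomputable def μneg (i : ℤ) : ∀ m : ℕ, J G (i - m) ⟶ J G i ⊗ J G (-(m : ℤ))
  | 0 => eqToHom (congrArg (J G) (by omega)) ≫ (ρ_ (J G i)).inv
  | m + 1 =>
      eqToHom (congrArg (J G) (show i - ((m:ℕ)+1:ℕ) = (i - m) - 1 by omega))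
        ≫ tMap (i - m) ≫ (μneg i m ▷ DIG G) ≫ (α_ (J G i) (J G (-(m:ℤ))) (DIG G)).hom
        ≫ (J G i ◁ (eqToHom (show J G (-(m:ℤ)) ⊗ DIG G = J G (-((m:ℕ)+1:ℕ)) by
            rw [J_neg, J_neg]; rfl)))

variable (G)

/-- The canonical comparison map `J (i+j) ⟶ J i ⊗ J j`, implementing the standard stable
equivalences between the syzygies `J`; it induces the cup product on Tate cohomology. -/
noncomputable def μ (i : ℤ) : ∀ j : ℤ, J G (i + j) ⟶ J G i ⊗ J G j
  | .ofNat m => μpos i m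
  | .negSucc m =>
      eqToHom (congrArg (J G) (show i + Int.negSucc m = i - ((m+1 : ℕ) : ℤ) by
        rw [Int.negSucc_eq]; push_cast; ring))
        ≫ μneg i (m+1)

variable {G}

/-! ### Tate cohomology in all degrees, functoriality, cup products -/

/-- Tate cohomology `Ĥ^n(G, M)` of the finite group `G` with coefficients in `M : Rep ℤ G`,
realized as `Ĥ⁰(G, Hom_ℤ(J n, M))` for the standard `n`-th syzygy `J n` of `ℤ`. -/
noncomputable def tate (n : ℤ) (M : Rep ℤ G) : Type := H0T (hRep (J G n) M)

noncomputable instance (n : ℤ) (M : Rep ℤ G) : AddCommGroup (tate n M) :=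
  inferInstanceAs (AddCommGroup (H0T (hRep (J G n) M)))

/-- The map on Tate cohomology induced by a morphism of representations. -/
noncomputable def tmap (n : ℤ) {M N : Rep ℤ G} (φ : M ⟶ N) : tate n M → tate n N :=
  H0Tmap ((Rep.ihom (J G n)).map φ)

/-- Transport of Tate cohomology along an equality of degrees. -/
noncomputable def tcast {i j : ℤ} {M : Rep ℤ G} (h : i = j) (z : tate i M) : tate j M :=
  h ▸ z

lemma hom_invariant {X W : Rep.{0} ℤ G} (m : X ⟶ W) :
    m.hom.toLinearMap ∈ (hRep X W).ρ.invariants := by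
  intro g
  show W.ρ g ∘ₗ m.hom.toLinearMap ∘ₗ X.ρ g⁻¹ = m.hom.toLinearMap
  ext v
  exact (congrArg (W.ρ g) (Rep.hom_comm_apply m g⁻¹ v)).trans
    (Representation.self_inv_apply W.ρ g _)

/-- The Tate cohomology class of a `G`-equivariant map `J n ⟶ W`. -/
noncomputable def mkCls {n : ℤ} {W : Rep ℤ G} (m : J G n ⟶ W) : tate n W :=
  tate0mk m.hom.toLinearMap (hom_invariant m)


lemma tensor_rho_eq (M N : Rep ℤ G) (g : G) :
    (M ⊗ N).ρ g = TensorProduct.map (M.ρ g) (N.ρ g) := rfl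

section TensorAux
variable {P A B C D : Type} [AddCommGroup P] [Module k P] [AddCommGroup A] [Module k A]
  [AddCommGroup B] [Module k B] [AddCommGroup C] [Module k C] [AddCommGroup D] [Module k D]

lemma map_conj (u : P →ₗ[k] A ⊗[k] B) (f : A →ₗ[k] C) (g : B →ₗ[k] D) (p : P →ₗ[k] P)
    (a : A →ₗ[k] A) (b : B →ₗ[k] B) (c : C →ₗ[k] C) (d : D →ₗ[k] D)
    (hf : c ∘ₗ f ∘ₗ a = f) (hg : d ∘ₗ g ∘ₗ b = g) (hu : u ∘ₗ p = TensorProduct.map a b ∘ₗ u) :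
    TensorProduct.map c d ∘ₗ (TensorProduct.map f g ∘ₗ u) ∘ₗ p = TensorProduct.map f g ∘ₗ u := by
  rw [LinearMap.comp_assoc, hu, ← LinearMap.comp_assoc,
    ← LinearMap.comp_assoc, ← TensorProduct.map_comp, ← TensorProduct.map_comp]
  rw [LinearMap.comp_assoc a f c, LinearMap.comp_assoc b g d, hf, hg]

lemma sum_map_comp {ι : Type} (s : Finset ι) (u : P →ₗ[k] A ⊗[k] B) (f : ι → A →ₗ[k] C)
    (g : B →ₗ[k] D) : TensorProduct.map (∑ h ∈ s, f h) g ∘ₗ u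
      = ∑ h ∈ s, TensorProduct.map (f h) g ∘ₗ u :=
  map_sum (((LinearMap.llcomp k _ _ _).flip u) ∘ₗ
    (TensorProduct.mapBilinear (RingHom.id k) A B C D).flip g) _ _

lemma map_sum_comp {ι : Type} (s : Finset ι) (u : P →ₗ[k] A ⊗[k] B) (f : A →ₗ[k] C)
    (g : ι → B →ₗ[k] D) : TensorProduct.map f (∑ h ∈ s, g h) ∘ₗ u
      = ∑ h ∈ s, TensorProduct.map f (g h) ∘ₗ u :=
  map_sum (((LinearMap.llcomp k _ _ _).flip u) ∘ₗ
    (TensorProduct.mapBilinear (RingHom.id k) A B C D) f) _ _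

lemma sub_map_comp (u : P →ₗ[k] A ⊗[k] B) (f f' : A →ₗ[k] C) (g : B →ₗ[k] D) :
    TensorProduct.map (f - f') g ∘ₗ u
      = TensorProduct.map f g ∘ₗ u - TensorProduct.map f' g ∘ₗ u :=
  map_sub (((LinearMap.llcomp k _ _ _).flip u) ∘ₗ
    (TensorProduct.mapBilinear (RingHom.id k) A B C D).flip g) _ _

lemma map_sub_comp (u : P →ₗ[k] A ⊗[k] B) (f : A →ₗ[k] C) (g g' : B →ₗ[k] D) :
    TensorProduct.map f (g - g') ∘ₗ u
      = TensorProduct.map f g ∘ₗ u - TensorProduct.map f g' ∘ₗ u :=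
  map_sub (((LinearMap.llcomp k _ _ _).flip u) ∘ₗ
    (TensorProduct.mapBilinear (RingHom.id k) A B C D) f) _ _

end TensorAux

lemma cup_invariance {i j : ℤ} {M N : Rep ℤ G}
    (f : ((hRep (J G i) M).ρ.invariants))
    (g : ((hRep (J G j) N).ρ.invariants)) :
    (TensorProduct.map f.1 g.1).comp ((μ G i j).hom.toLinearMap)
      ∈ (hRep (J G (i + j)) (M ⊗ N)).ρ.invariants := by
  intro gg
  have hf : M.ρ gg ∘ₗ f.1 ∘ₗ (J G i).ρ gg⁻¹ = f.1 := f.2 gg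
  have hg : N.ρ gg ∘ₗ g.1 ∘ₗ (J G j).ρ gg⁻¹ = g.1 := g.2 gg
  have hμ : (μ G i j).hom.toLinearMap.comp ((J G (i + j)).ρ gg⁻¹)
      = (TensorProduct.map ((J G i).ρ gg⁻¹) ((J G j).ρ gg⁻¹)).comp (μ G i j).hom.toLinearMap := by
    have h := (μ G i j).hom.isIntertwining' gg⁻¹
    exact h
  show (M ⊗ N).ρ gg ∘ₗ ((TensorProduct.map f.1 g.1).comp (μ G i j).hom.toLinearMap)
        ∘ₗ (J G (i + j)).ρ gg⁻¹
      = (TensorProduct.map f.1 g.1).comp (μ G i j).hom.toLinearMap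
  exact map_conj (μ G i j).hom.toLinearMap f.1 g.1 _ _ _ _ _ hf hg hμ

lemma conj_term {i j : ℤ} {M N : Rep ℤ G} (u : (J G i).V →ₗ[ℤ] M.V)
    (w : (J G j).V →ₗ[ℤ] N.V) (h : G) :
    (TensorProduct.map (M.ρ h ∘ₗ u ∘ₗ (J G i).ρ h⁻¹) (N.ρ h ∘ₗ w ∘ₗ (J G j).ρ h⁻¹)).comp
        (μ G i j).hom.toLinearMap
      = ((hRep (J G (i + j)) (M ⊗ N)).ρ h) ((TensorProduct.map u w).comp (μ G i j).hom.toLinearMap) := by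
  have hμ : (μ G i j).hom.toLinearMap ∘ₗ (J G (i + j)).ρ h⁻¹
      = TensorProduct.map ((J G i).ρ h⁻¹) ((J G j).ρ h⁻¹) ∘ₗ (μ G i j).hom.toLinearMap := by
    have hc := (μ G i j).hom.isIntertwining' h⁻¹
    exact hc
  show _ = (M ⊗ N).ρ h ∘ₗ ((TensorProduct.map u w).comp (μ G i j).hom.toLinearMap) ∘ₗ (J G (i + j)).ρ h⁻¹
  rw [LinearMap.comp_assoc, hμ, ← LinearMap.comp_assoc, ← LinearMap.comp_assoc]
  rw [TensorProduct.map_comp, TensorProduct.map_comp]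
  rfl

lemma cup_norm_left {i j : ℤ} {M N : Rep ℤ G} (u : (J G i).V →ₗ[ℤ] M.V)
    (g : ((hRep (J G j) N).ρ.invariants)) :
    (TensorProduct.map (rnorm ((hRep (J G i) M).ρ) u) g.1).comp (μ G i j).hom.toLinearMap
      = rnorm ((hRep (J G (i + j)) (M ⊗ N)).ρ)
          ((TensorProduct.map u g.1).comp (μ G i j).hom.toLinearMap) := by
  have h1 : rnorm ((hRep (J G i) M).ρ) u = ∑ h : G, ((hRep (J G i) M).ρ h) u := by
    exact LinearMap.sum_apply _ _ _
  have h2 : rnorm ((hRep (J G (i + j)) (M ⊗ N)).ρ) ((TensorProduct.map u g.1).comp (μ G i j).hom.toLinearMap)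
      = ∑ h : G, ((hRep (J G (i + j)) (M ⊗ N)).ρ h)
          ((TensorProduct.map u g.1).comp (μ G i j).hom.toLinearMap) := by
    exact LinearMap.sum_apply _ _ _
  refine (congrArg (fun t => (TensorProduct.map t g.1).comp (μ G i j).hom.toLinearMap) h1).trans (Eq.trans ?_ h2.symm)
  refine (sum_map_comp Finset.univ (μ G i j).hom.toLinearMap (fun h => ((hRep (J G i) M).ρ h) u) g.1).trans ?_
  refine Finset.sum_congr rfl fun h _ => ?_
  have hginv : N.ρ h ∘ₗ g.1 ∘ₗ (J G j).ρ h⁻¹ = g.1 := g.2 h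
  rw [← conj_term u g.1 h, hginv]
  rfl

lemma cup_norm_right {i j : ℤ} {M N : Rep ℤ G}
    (f : ((hRep (J G i) M).ρ.invariants)) (w : (J G j).V →ₗ[ℤ] N.V) :
    (TensorProduct.map f.1 (rnorm ((hRep (J G j) N).ρ) w)).comp (μ G i j).hom.toLinearMap
      = rnorm ((hRep (J G (i + j)) (M ⊗ N)).ρ)
          ((TensorProduct.map f.1 w).comp (μ G i j).hom.toLinearMap) := by
  have h1 : rnorm ((hRep (J G j) N).ρ) w = ∑ h : G, ((hRep (J G j) N).ρ h) w := by
    exact LinearMap.sum_apply _ _ _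
  have h2 : rnorm ((hRep (J G (i + j)) (M ⊗ N)).ρ) ((TensorProduct.map f.1 w).comp (μ G i j).hom.toLinearMap)
      = ∑ h : G, ((hRep (J G (i + j)) (M ⊗ N)).ρ h)
          ((TensorProduct.map f.1 w).comp (μ G i j).hom.toLinearMap) := by
    exact LinearMap.sum_apply _ _ _
  refine (congrArg (fun t => (TensorProduct.map f.1 t).comp (μ G i j).hom.toLinearMap) h1).trans (Eq.trans ?_ h2.symm)
  refine (map_sum_comp Finset.univ (μ G i j).hom.toLinearMap f.1 (fun h => ((hRep (J G j) N).ρ h) w)).trans ?_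
  refine Finset.sum_congr rfl fun h _ => ?_
  have hfinv : M.ρ h ∘ₗ f.1 ∘ₗ (J G i).ρ h⁻¹ = f.1 := f.2 h
  rw [← conj_term f.1 w h, hfinv]
  rfl

lemma cup_welldef {i j : ℤ} {M N : Rep ℤ G}
    (a₁ : ((hRep (J G i) M).ρ.invariants)) (b₁ : ((hRep (J G j) N).ρ.invariants))
    (a₂ : ((hRep (J G i) M).ρ.invariants)) (b₂ : ((hRep (J G j) N).ρ.invariants))
    (ha : a₁ - a₂ ∈ rnormIm ((hRep (J G i) M).ρ))
    (hb : b₁ - b₂ ∈ rnormIm ((hRep (J G j) N).ρ)) :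
    tate0mk (ρ := (hRep (J G (i + j)) (M ⊗ N)).ρ) ((TensorProduct.map a₁.1 b₁.1).comp ((μ G i j).hom.toLinearMap)) (cup_invariance a₁ b₁)
      = tate0mk (ρ := (hRep (J G (i + j)) (M ⊗ N)).ρ) ((TensorProduct.map a₂.1 b₂.1).comp ((μ G i j).hom.toLinearMap)) (cup_invariance a₂ b₂) := by
  obtain ⟨u, hu⟩ := ha
  obtain ⟨w, hw⟩ := hb
  have hu' : rnorm ((hRep (J G i) M).ρ) u = a₁.1 - a₂.1 := congrArg Subtype.val hu
  have hw' : rnorm ((hRep (J G j) N).ρ) w = b₁.1 - b₂.1 := congrArg Subtype.val hw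
  have step1 : tate0mk (ρ := (hRep (J G (i + j)) (M ⊗ N)).ρ) ((TensorProduct.map a₁.1 b₁.1).comp ((μ G i j).hom.toLinearMap))
        (cup_invariance a₁ b₁)
      = tate0mk (ρ := (hRep (J G (i + j)) (M ⊗ N)).ρ) ((TensorProduct.map a₂.1 b₁.1).comp ((μ G i j).hom.toLinearMap)) (cup_invariance a₂ b₁) := by
    refine (Submodule.Quotient.eq (rnormIm (hRep (J G (i + j)) (M ⊗ N)).ρ)).mpr ?_
    refine ⟨(TensorProduct.map u b₁.1).comp ((μ G i j).hom.toLinearMap), ?_⟩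
    apply Subtype.ext
    have key := (congrArg (fun t => (TensorProduct.map t b₁.1).comp (μ G i j).hom.toLinearMap) hu').symm.trans
      (cup_norm_left u b₁)
    refine key.symm.trans ?_
    exact sub_map_comp (μ G i j).hom.toLinearMap a₁.1 a₂.1 b₁.1
  have step2 : tate0mk (ρ := (hRep (J G (i + j)) (M ⊗ N)).ρ) ((TensorProduct.map a₂.1 b₁.1).comp ((μ G i j).hom.toLinearMap))
        (cup_invariance a₂ b₁)
      = tate0mk (ρ := (hRep (J G (i + j)) (M ⊗ N)).ρ) ((TensorProduct.map a₂.1 b₂.1).comp ((μ G i j).hom.toLinearMap)) (cup_invariance a₂ b₂) := by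
    refine (Submodule.Quotient.eq (rnormIm (hRep (J G (i + j)) (M ⊗ N)).ρ)).mpr ?_
    refine ⟨(TensorProduct.map a₂.1 w).comp ((μ G i j).hom.toLinearMap), ?_⟩
    apply Subtype.ext
    have key := (congrArg (fun t => (TensorProduct.map a₂.1 t).comp (μ G i j).hom.toLinearMap) hw').symm.trans
      (cup_norm_right a₂ w)
    refine key.symm.trans ?_
    exact map_sub_comp (μ G i j).hom.toLinearMap a₂.1 b₁.1 b₂.1
  exact step1.trans step2

/-- The cup product `Ĥ^i(G, M) × Ĥ^j(G, N) → Ĥ^{i+j}(G, M ⊗ N)` on Tate cohomology,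
induced by the comparison maps `μ`. -/
noncomputable def cup {i j : ℤ} {M N : Rep ℤ G} (z₁ : tate i M) (z₂ : tate j N) :
    tate (i + j) (M ⊗ N) :=
  Quotient.liftOn₂ z₁ z₂
    (fun f g => tate0mk ((TensorProduct.map f.1 g.1).comp ((μ G i j).hom.toLinearMap)) (cup_invariance f g))
    (fun a₁ b₁ a₂ b₂ ha hb => cup_welldef a₁ b₁ a₂ b₂
      ((Submodule.quotientRel_def _).mp ha) ((Submodule.quotientRel_def _).mp hb))

/-! ### Pairings -/

/-- The composition pairing `Hom_ℤ(B, C) ⊗ Hom_ℤ(A, B) ⟶ Hom_ℤ(A, C)`, `f ⊗ φ ↦ f ∘ φ`. -/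
noncomputable def compPair (A B C : Rep ℤ G) : hRep B C ⊗ hRep A B ⟶ hRep A C :=
  MonoidalClosed.curry <|
    (A ◁ (β_ (hRep B C) (hRep A B)).hom) ≫ (α_ A (hRep A B) (hRep B C)).inv
      ≫ (((ihom.ev A).app B) ▷ hRep B C) ≫ (ihom.ev B).app C

/-- The evaluation pairing `Hom_ℤ(X, B) ⊗ X ⟶ B`, `f ⊗ x ↦ f x`. -/
noncomputable def evPair (X B : Rep ℤ G) : hRep X B ⊗ X ⟶ B :=
  (β_ (hRep X B) X).hom ≫ (ihom.ev X).app B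

/-- The cup product `Ĥ^i(G, Hom(X, A)) × Ĥ^j(G, Hom(X', X)) → Ĥ^{i+j}(G, Hom(X', A))`
induced by the composition pairing. -/
noncomputable def ccup {i j : ℤ} {X X' A : Rep ℤ G}
    (z : tate i (hRep X A)) (x : tate j (hRep X' X)) : tate (i + j) (hRep X' A) :=
  tmap (i + j) (compPair X' X A) (cup z x)

/-- `ccup`, with the degree of the target adjusted along an equality of integers. -/
noncomputable def ccupTo {i j m : ℤ} {X X' A : Rep ℤ G}
    (z : tate i (hRep X A)) (x : tate j (hRep X' X)) (h : i + j = m) :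
    tate m (hRep X' A) :=
  tcast h (ccup z x)

/-- The class of the identity in `Ĥ⁰(G, Hom_ℤ(X, X))`. -/
noncomputable def idCls (X : Rep ℤ G) : tate 0 (hRep X X) :=
  mkCls (MonoidalClosed.curry (ρ_ X).hom)

/-! ### Encoding pairs and related notions -/

/-- `(X, X')` is an *`r`-encoding pair* if for some `i ∈ ℤ` there is a natural isomorphism
of functors `Ĥ^i(G, Hom_ℤ(X, -)) ≅ Ĥ^{i+r}(G, Hom_ℤ(X', -))` on `Rep ℤ G`. -/
def IsEncodingPair {G : Type} [Group G] [Fintype G] (r : ℤ) (X X' : Rep ℤ G) : Prop :=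
  ∃ (i : ℤ) (e : ∀ A : Rep ℤ G, tate i (hRep X A) ≃+ tate (i + r) (hRep X' A)),
    ∀ {A B : Rep ℤ G} (φ : A ⟶ B) (z : tate i (hRep X A)),
      e B (tmap i ((Rep.ihom X).map φ) z) = tmap (i + r) ((Rep.ihom X').map φ) (e A z)

/-- `x ∈ Ĥ^r(G, Hom_ℤ(X', X))` is an *encoding element* for the pair `(X, X')` if it has a
*decoding element* `x' ∈ Ĥ^{-r}(G, Hom_ℤ(X, X'))` with `x' ∪ x = [id_{X'}]` and
`x ∪ x' = [id_X]`. -/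
def IsEncodingElement {G : Type} [Group G] [Fintype G] {r : ℤ} (X X' : Rep ℤ G)
    (x : tate r (hRep X' X)) : Prop :=
  ∃ x' : tate (-r) (hRep X X'),
    ccupTo x' x (by ring) = idCls X' ∧ ccupTo x x' (by ring) = idCls X

/-- The induced `G`-module `ℤ[G] ⊗_ℤ A ≅ (G →₀ A)`, with `G` acting by left translation. -/
noncomputable def indRep (G : Type) [Group G] (A : Type) [AddCommGroup A] [Module ℤ A] :
    Rep ℤ G :=
  Rep.of (G := G) (X := G →₀ A)
    { toFun := fun g => Finsupp.lmapDomain A ℤ (fun h => g * h)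
      map_one' := by
        ext x h
        simp [Finsupp.lmapDomain_apply, Finsupp.mapDomain_id, one_mul]
      map_mul' := fun g g' => by
        ext x h
        simp [Finsupp.lmapDomain_apply, Module.End.mul_apply, Finsupp.mapDomain_single,
          mul_assoc] }

/-- A `G`-module is *induced* if it is isomorphic to `ℤ[G] ⊗_ℤ A` for some abelian group `A`. -/
def IsInduced {G : Type} [Group G] (M : Rep ℤ G) : Prop :=
  ∃ (A : Type) (_ : AddCommGroup A) (_ : Module ℤ A), Nonempty (M ≅ indRep G A)

/-- A class `φ ∈ Ĥ⁰(G, Hom_ℤ(X, X))` is a unit for the (composition) cup product. -/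
def IsUnitCls {G : Type} [Group G] [Fintype G] {X : Rep ℤ G}
    (φ : tate 0 (hRep X X)) : Prop :=
  ∃ ψ : tate 0 (hRep X X),
    ccupTo φ ψ (by ring) = idCls X ∧ ccupTo ψ φ (by ring) = idCls X


/-- The natural map `Hom_ℤ(X, A) ⊗ I_G ⟶ Hom_ℤ(X, A ⊗ I_G)`, `f ⊗ z ↦ (x ↦ f x ⊗ z)`. -/
noncomputable def pr0 (X A : Rep ℤ G) : hRep X A ⊗ IGrep G ⟶ hRep X (A ⊗ IGrep G) :=
  MonoidalClosed.curry ((α_ X (hRep X A) (IGrep G)).inv ≫ ((ihom.ev X).app A ▷ IGrep G))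

/-- The natural evaluation map `Hom_ℤ(X, Hom_ℤ(I_G, A)) ⊗ I_G ⟶ Hom_ℤ(X, A)`,
`f ⊗ z ↦ (x ↦ f x z)`. -/
noncomputable def pr1 (X A : Rep ℤ G) :
    hRep X (hRep (IGrep G) A) ⊗ IGrep G ⟶ hRep X A :=
  MonoidalClosed.curry ((α_ X (hRep X (hRep (IGrep G) A)) (IGrep G)).inv
    ≫ ((ihom.ev X).app (hRep (IGrep G) A) ▷ IGrep G) ≫ evPair (IGrep G) A)

/-- The natural evaluation map `Hom_ℤ(X', X) ⊗ (X' ⊗ A) ⟶ X ⊗ A`. -/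
noncomputable def tPair (X' X A : Rep ℤ G) : hRep X' X ⊗ (X' ⊗ A) ⟶ X ⊗ A :=
  (α_ (hRep X' X) X' A).inv ≫ (evPair X' X ▷ A)

/-- A functor `Rep ℤ G ⥤ Rep ℤ G` sends `ℤ`-split short exact sequences of `G`-modules to
short exact sequences of `G`-modules. -/
def PreservesZSplitSES {G : Type} [Group G] (F : Rep.{0} ℤ G ⥤ Rep.{0} ℤ G) : Prop :=
  ∀ (A B C : Rep ℤ G) (f : A ⟶ B) (g : B ⟶ C),
    Function.Injective f.hom → Function.Surjective g.hom → Function.Exact f.hom g.hom →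
    (∃ s : C.V →+ B.V, ∀ x, g.hom (s x) = x) →
    Function.Injective (F.map f).hom ∧ Function.Surjective (F.map g).hom ∧
      Function.Exact (F.map f).hom (F.map g).hom

/-- A *shiftable functor*: it sends `ℤ`-split short exact sequences of `G`-modules to short
exact sequences, and sends induced modules to induced modules. -/
def Shiftable {G : Type} [Group G] (F : Rep ℤ G ⥤ Rep ℤ G) : Prop :=
  PreservesZSplitSES F ∧ ∀ M : Rep ℤ G, IsInduced M → IsInduced (F.obj M)

end Enc

open CategoryTheory MonoidalCategory Enc



namespace Enc

section Core

/-- An additive map, viewed as `ℤ`-linear for arbitrary `ℤ`-module structures. -/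
def toLin {A B : Type} [AddCommGroup A] [AddCommGroup B] [Module ℤ A] [Module ℤ B]
    (f : A →+ B) : A →ₗ[ℤ] B :=
  { f with
    map_smul' := fun c x => by
      have := map_intCast_smul f ℤ ℤ c x
      simpa using this }

@[simp] lemma toLin_apply {A B : Type} [AddCommGroup A] [AddCommGroup B] [Module ℤ A]
    [Module ℤ B] (f : A →+ B) (a : A) : toLin f a = f a := rfl

/-- Extension of characters along injections, with a rational lift. -/
lemma exists_rat_lift {A B : Type} [AddCommGroup A] [AddCommGroup B] [Module ℤ A] [Module ℤ B]
    [Module.Free ℤ B] (j : A →ₗ[ℤ] B) (hj : Function.Injective j)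
    (c : A →+ AddCircle (1 : ℚ)) :
    ∃ H : B →ₗ[ℤ] ℚ, ∀ a, ((H (j a) : ℚ) : AddCircle (1 : ℚ)) = c a := by
  obtain ⟨C, hC⟩ := CharacterModule.dual_surjective_of_injective j hj c
  let C' : B →+ AddCircle (1 : ℚ) := C
  let q : ℚ →+ AddCircle (1 : ℚ) := QuotientAddGroup.mk' _
  obtain ⟨H, hH⟩ := Module.projective_lifting_property (toLin q) (toLin C')
    (QuotientAddGroup.mk'_surjective _)
  refine ⟨H, fun a => ?_⟩
  have h1 : q (H (j a)) = C' (j a) := congrArg (fun t => t (j a)) hH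
  have h2 : C' (j a) = c a := DFunLike.congr_fun hC a
  exact h1.trans h2

/-- An additive rational-valued map with integer values. -/
lemma exists_int_valued {A : Type} [AddCommGroup A] [Module ℤ A] (H : A →ₗ[ℤ] ℚ)
    (hH : ∀ a, ((H a : ℚ) : AddCircle (1 : ℚ)) = 0) :
    ∃ F : A →ₗ[ℤ] ℤ, ∀ a, (F a : ℚ) = H a := by
  have h : ∀ a, ∃ n : ℤ, (n : ℚ) = H a := fun a => by
    obtain ⟨n, hn⟩ := (AddCircle.coe_eq_zero_iff (1 : ℚ)).mp (hH a)
    exact ⟨n, by simpa using hn⟩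
  choose F hF using h
  refine ⟨toLin ⟨⟨F, ?_⟩, ?_⟩, hF⟩
  · have := hF 0
    rw [map_zero] at this
    exact_mod_cast this
  · intro x y
    have := hF (x + y)
    rw [map_add, ← hF, ← hF] at this
    exact_mod_cast this

variable {G : Type} [Group G] [Fintype G] {Y : Type} [AddCommGroup Y] [Module ℤ Y]
  [Module.Free ℤ Y] (ρ : Representation ℤ G Y)

lemma core_inj (f : Y →ₗ[ℤ] ℤ) (hf : ∀ g y, f (ρ g y) = f y)
    (hd : ∀ y ∈ ρ.invariants, (Fintype.card G : ℤ) ∣ f y) :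
    ∃ φ : Y →ₗ[ℤ] ℤ, ∀ y, φ (rnorm ρ y) = f y := by
  have hn : (Fintype.card G : ℚ) ≠ 0 := by exact_mod_cast Fintype.card_ne_zero
  -- the rational map `f / n`
  let fQ : Y →ₗ[ℤ] ℚ := toLin
    ((AddMonoidHom.mulRight ((Fintype.card G : ℚ)⁻¹)).comp
      ((Int.castAddHom ℚ).comp f.toAddMonoidHom))
  have hfQ : ∀ y, fQ y = (f y : ℚ) * (Fintype.card G : ℚ)⁻¹ := fun y => rfl
  -- the map `y ↦ (g y - y)_g`
  let d : Y →ₗ[ℤ] (G → Y) := LinearMap.pi fun g => ρ g - LinearMap.id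
  have hdk : LinearMap.ker d = ρ.invariants := by
    ext y
    simp only [LinearMap.mem_ker, Representation.mem_invariants]
    constructor
    · intro h g
      have := congrFun h g
      exact sub_eq_zero.mp this
    · intro h
      funext g
      exact sub_eq_zero.mpr (h g)
  let c : Y →+ AddCircle (1 : ℚ) := (QuotientAddGroup.mk' _).comp fQ.toAddMonoidHom
  have hc : ∀ y, c y = ((fQ y : ℚ) : AddCircle (1 : ℚ)) := fun y => rfl
  have hck : LinearMap.ker d ≤ LinearMap.ker (toLin c) := by
    rw [hdk]
    intro y hy
    obtain ⟨k, hk⟩ := hd y hy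
    rw [LinearMap.mem_ker, toLin_apply, hc, AddCircle.coe_eq_zero_iff]
    refine ⟨k, ?_⟩
    rw [hfQ, hk]
    push_cast
    field_simp
    simp
  let c' : (Y ⧸ LinearMap.ker d) →ₗ[ℤ] AddCircle (1 : ℚ) := (LinearMap.ker d).liftQ (toLin c) hck
  obtain ⟨H, hH⟩ := exists_rat_lift ((LinearMap.ker d).liftQ d le_rfl)
    (LinearMap.ker_eq_bot.mp (Submodule.ker_liftQ_eq_bot' _ _ rfl)) c'.toAddMonoidHom
  have hH' : ∀ y, ((H (d y) : ℚ) : AddCircle (1 : ℚ)) = ((fQ y : ℚ) : AddCircle (1 : ℚ)) :=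
    fun y => hH (Submodule.Quotient.mk y)
  obtain ⟨φ, hφ⟩ := exists_int_valued (fQ - H ∘ₗ d) (fun a => by
    rw [LinearMap.sub_apply, LinearMap.comp_apply, AddCircle.coe_sub, hH', sub_self])
  refine ⟨φ, fun y => ?_⟩
  have h0 : d (rnorm ρ y) = 0 := by
    have : rnorm ρ y ∈ LinearMap.ker d := hdk ▸ rnorm_mem_invariants ρ y
    exact this
  have hs : f (rnorm ρ y) = Fintype.card G * f y := by
    simp [rnorm, LinearMap.sum_apply, hf]
  have := hφ (rnorm ρ y)
  rw [LinearMap.sub_apply, LinearMap.comp_apply, h0, map_zero, sub_zero, hfQ, hs] at this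
  push_cast at this
  field_simp at this
  exact_mod_cast this

/-- The embedding `ℤ/n → ℚ/ℤ`. -/
lemma exists_zmod_embed (n : ℕ) (hn : n ≠ 0) : ∃ e : ZMod n →+ AddCircle (1 : ℚ),
    Function.Injective e ∧ ∀ a : ℤ, e (a : ZMod n) = (((a : ℚ) * (n : ℚ)⁻¹ : ℚ) : AddCircle (1 : ℚ)) := by
  have hn' : (n : ℚ) ≠ 0 := by exact_mod_cast hn
  let t : ℤ →+ AddCircle (1 : ℚ) := (QuotientAddGroup.mk' _).comp
    ((AddMonoidHom.mulRight ((n : ℚ)⁻¹)).comp (Int.castAddHom ℚ))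
  have ht : ∀ a : ℤ, t a = (((a : ℚ) * (n : ℚ)⁻¹ : ℚ) : AddCircle (1 : ℚ)) := fun a => rfl
  have h0 : t (n : ℤ) = 0 := by
    rw [ht, AddCircle.coe_eq_zero_iff]
    exact ⟨1, by push_cast; field_simp; simp⟩
  refine ⟨ZMod.lift n ⟨t, h0⟩, ?_, fun a => by rw [ZMod.lift_coe]; exact ht a⟩
  rw [ZMod.lift_injective]
  intro m hm
  change t m = 0 at hm
  rw [ht, AddCircle.coe_eq_zero_iff] at hm
  obtain ⟨k, hk⟩ := hm
  rw [ZMod.intCast_zmod_eq_zero_iff_dvd]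
  refine ⟨k, ?_⟩
  field_simp at hk
  have : (m : ℚ) = n * k := by rw [← hk]; simp [mul_comm]
  exact_mod_cast this

lemma core_surj (h : ρ.invariants →+ ZMod (Fintype.card G))
    (hh : ∀ y, h (rnormRes ρ y) = 0) :
    ∃ F : Y →ₗ[ℤ] ℤ, (∀ g y, F (ρ g y) = F y) ∧
      ∀ y : ρ.invariants, ((F y.1 : ℤ) : ZMod (Fintype.card G)) = h y := by
  have hn0 : Fintype.card G ≠ 0 := Fintype.card_ne_zero
  have hn : (Fintype.card G : ℚ) ≠ 0 := by exact_mod_cast hn0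
  obtain ⟨e, he, hev⟩ := exists_zmod_embed (Fintype.card G) hn0
  obtain ⟨H, hH⟩ := exists_rat_lift ρ.invariants.subtype Subtype.val_injective (e.comp h)
  obtain ⟨F, hF⟩ := exists_int_valued (H ∘ₗ rnorm ρ) (fun a => by
    have := hH (rnormRes ρ a)
    rw [AddMonoidHom.comp_apply, hh, map_zero] at this
    exact this)
  refine ⟨F, fun g y => ?_, fun y => ?_⟩
  · have h1 : rnorm ρ (ρ g y) = rnorm ρ y := by
      simp only [rnorm, LinearMap.sum_apply]
      exact Fintype.sum_equiv (Equiv.mulRight g) _ _ (fun h => by simp)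
    have := hF (ρ g y)
    rw [LinearMap.comp_apply, h1] at this
    have h2 := hF y
    rw [LinearMap.comp_apply, ← this] at h2
    symm
    exact_mod_cast h2
  · apply he
    have h1 : rnorm ρ y.1 = (Fintype.card G) • y.1 := by
      simp only [rnorm, LinearMap.sum_apply]
      rw [Finset.sum_congr rfl fun g _ => y.2 g]
      simp
    have h2 := hF y.1
    rw [LinearMap.comp_apply, h1, map_nsmul, nsmul_eq_mul] at h2
    have h3 := hH y
    rw [hev, h2]
    rw [AddMonoidHom.comp_apply] at h3
    rw [← h3]
    congr 1
    simp only [Submodule.subtype_apply]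
    field_simp

end Core

end Enc


namespace Enc

section Perf

/-- A copairing `P → A ⊗ B` is perfect if it induces bijections `Hom(A, M) → Hom(P, M ⊗ B)`. -/
def Perf {k : Type} [CommRing k] {P A B : Type} [AddCommGroup P] [Module k P] [AddCommGroup A] [Module k A]
    [AddCommGroup B] [Module k B] (u : P →ₗ[k] A ⊗[k] B) : Prop :=
  ∀ (M : Type) [AddCommGroup M] [Module k M],
    Function.Bijective (fun f : A →ₗ[k] M => (f.rTensor B ∘ₗ u : P →ₗ[k] M ⊗[k] B))

variable {k : Type} [CommRing k] {P A B C D : Type} [AddCommGroup P] [Module k P] [AddCommGroup A] [Module k A]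
    [AddCommGroup B] [Module k B] [AddCommGroup C] [Module k C] [AddCommGroup D] [Module k D]

lemma perf_rid : Perf ((TensorProduct.rid k A).symm.toLinearMap) := by
  intro M _ _
  have h : ∀ f : A →ₗ[k] M, f.rTensor k ∘ₗ (TensorProduct.rid k A).symm.toLinearMap
      = (TensorProduct.rid k M).symm.toLinearMap ∘ₗ f := by
    intro f
    ext a
    simp
  constructor
  · intro f f' hff
    simp only [h] at hff
    ext a
    exact (TensorProduct.rid k M).symm.injective (LinearMap.congr_fun hff a)
  · intro q
    refine ⟨(TensorProduct.rid k M).toLinearMap ∘ₗ q, ?_⟩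
    simp only [h]
    ext a
    simp

lemma perf_step (u : P →ₗ[k] A ⊗[k] B) (hu : Perf u) (v : A →ₗ[k] C ⊗[k] D) (hv : Perf v) :
    Perf ((TensorProduct.assoc k C D B).toLinearMap ∘ₗ v.rTensor B ∘ₗ u) := by
  intro M _ _
  have h : ∀ f : C →ₗ[k] M,
      f.rTensor (D ⊗[k] B) ∘ₗ (TensorProduct.assoc k C D B).toLinearMap ∘ₗ v.rTensor B ∘ₗ u
      = (TensorProduct.assoc k M D B).toLinearMap ∘ₗ ((f.rTensor D ∘ₗ v).rTensor B ∘ₗ u) := by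
    intro f
    have : f.rTensor (D ⊗[k] B) ∘ₗ (TensorProduct.assoc k C D B).toLinearMap
        = (TensorProduct.assoc k M D B).toLinearMap ∘ₗ (f.rTensor D).rTensor B := by
      ext x y z
      simp
    rw [← LinearMap.comp_assoc, this, LinearMap.rTensor_comp]
    rfl
  have hb : Function.Bijective (fun q : P →ₗ[k] (M ⊗[k] D) ⊗[k] B =>
      (TensorProduct.assoc k M D B).toLinearMap ∘ₗ q) :=
    (LinearEquiv.congrRight (TensorProduct.assoc k M D B)).bijective
  simp only [h]
  exact hb.comp ((hu (M ⊗[k] D)).comp (hv M))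

/-- The basic nondegeneracy statement, for an element built from a pair of bases. -/
lemma elt_bij {ι : Type} [Fintype ι] (b : Module.Basis ι k B) (d : Module.Basis ι k D)
    (M : Type) [AddCommGroup M] [Module k M] :
    Function.Bijective (fun f : B →ₗ[k] M => f.rTensor D (∑ r, b r ⊗ₜ[k] d r)) := by
  classical
  have h : (fun f : B →ₗ[k] M => f.rTensor D (∑ r, b r ⊗ₜ[k] d r))
      = ⇑((b.constr k).symm ≪≫ₗ (Finsupp.linearEquivFunOnFinite k M ι).symm
        ≪≫ₗ (TensorProduct.equivFinsuppOfBasisRight (M := M) d).symm) := by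
    funext f
    simp only [map_sum, LinearMap.rTensor_tmul, LinearEquiv.trans_apply,
      TensorProduct.equivFinsuppOfBasisRight_symm_apply]
    rw [Finsupp.sum_fintype _ _ (by simp)]
    rfl
  rw [h]
  exact LinearEquiv.bijective _

lemma perf_base (w : B ⊗[k] D)
    (hw : ∀ (M : Type) [AddCommGroup M] [Module k M],
      Function.Bijective (fun f : B →ₗ[k] M => f.rTensor D w)) :
    Perf ((TensorProduct.assoc k P B D).symm.toLinearMap ∘ₗ
      (LinearMap.toSpanSingleton k _ w).lTensor P ∘ₗ
      (TensorProduct.rid k P).symm.toLinearMap) := by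
  intro M _ _
  let E : (B →ₗ[k] M) ≃ₗ[k] M ⊗[k] D :=
    LinearEquiv.ofBijective (
      { toFun := fun f : B →ₗ[k] M => f.rTensor D w
        map_add' := fun f g => by simp [LinearMap.rTensor_add]
        map_smul' := fun c g => by simp [LinearMap.rTensor_smul] }) (hw M)
  have hE : ∀ f, E f = f.rTensor D w := fun f => rfl
  have key : ∀ (f : P ⊗[k] B →ₗ[k] M) (p : P) (z : B ⊗[k] D),
      f.rTensor D ((TensorProduct.assoc k P B D).symm (p ⊗ₜ z))
        = (TensorProduct.curry f p).rTensor D z := by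
    intro f p z
    induction z with
    | zero => simp
    | tmul x y => simp
    | add x y hx hy => rw [TensorProduct.tmul_add, map_add, map_add, hx, hy, map_add]
  have h : (fun f : P ⊗[k] B →ₗ[k] M => f.rTensor D ∘ₗ
      (TensorProduct.assoc k P B D).symm.toLinearMap ∘ₗ
      (LinearMap.toSpanSingleton k _ w).lTensor P ∘ₗ
      (TensorProduct.rid k P).symm.toLinearMap)
      = (LinearEquiv.congrRight E (M := P)) ∘ ⇑(TensorProduct.lift.equiv (.id k) P B M).symm := by
    funext f
    ext p
    simp only [LinearMap.comp_apply, LinearEquiv.coe_coe, TensorProduct.rid_symm_apply,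
      LinearMap.lTensor_tmul, LinearMap.toSpanSingleton_apply, one_smul]
    rw [key]
    rfl
  rw [h]
  exact (LinearEquiv.bijective _).comp (LinearEquiv.bijective _)

lemma final_bij {ι : Type} [Fintype ι] {X L : Type} [AddCommGroup X] [Module k X]
    [AddCommGroup L] [Module k L] (b : Module.Basis ι k L)
    (T : (X →ₗ[k] k) ⊗[k] L →ₗ[k] ((L →ₗ[k] X) →ₗ[k] k))
    (hT : ∀ α l y, T (α ⊗ₜ l) y = α (y l)) : Function.Bijective T := by
  classical
  let E := TensorProduct.equivFinsuppOfBasisRight (M := X →ₗ[k] k) b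
  have hE : ∀ (t : ι →₀ (X →ₗ[k] k)) (y : L →ₗ[k] X), T (E.symm t) y = ∑ r, t r (y (b r)) := by
    intro t y
    simp only [E, TensorProduct.equivFinsuppOfBasisRight_symm_apply]
    rw [Finsupp.sum_fintype _ _ (by simp), map_sum, LinearMap.sum_apply]
    simp [hT]
  constructor
  · rw [injective_iff_map_eq_zero]
    intro z hz
    obtain ⟨t, rfl⟩ := E.symm.surjective z
    suffices t = 0 by rw [this, map_zero]
    ext r x
    have := hE t (b.constr k (Pi.single r x))
    rw [hz, Finset.sum_eq_single r] at this
    · simpa using this.symm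
    · intro j _ hj
      simp [Module.Basis.constr_basis, Pi.single_eq_of_ne hj]
    · simp
  · intro F
    refine ⟨E.symm (Finsupp.equivFunOnFinite.symm fun r =>
      F ∘ₗ (b.constr k).toLinearMap ∘ₗ LinearMap.single k (fun _ => X) r), ?_⟩
    ext y
    rw [hE]
    simp only [Finsupp.equivFunOnFinite_symm_apply_apply, LinearMap.comp_apply]
    rw [← map_sum, ← map_sum]
    congr 1
    apply b.ext
    intro r
    simp [Module.Basis.constr_basis, Finset.sum_apply, Pi.single_apply]

end Perf

end Enc


namespace Enc

section RPerf

variable {G : Type} [Group G]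

/-- Perfectness of a copairing in `Rep ℤ G`. -/
def RPerf {P A B : Rep.{0} ℤ G} (u : P ⟶ A ⊗ B) : Prop :=
  Perf (k := ℤ) (P := P.V) (A := A.V) (B := B.V) u.hom.toLinearMap

lemma rperf_eqToHom {P P' A B : Rep.{0} ℤ G} (h : P' = P) (u : P ⟶ A ⊗ B) (hu : RPerf u) :
    RPerf (eqToHom h ≫ u) := by
  subst h
  simpa using hu

lemma rperf_whisker {P A B B' : Rep.{0} ℤ G} (h : B = B') (u : P ⟶ A ⊗ B) (hu : RPerf u) :
    RPerf (u ≫ A ◁ eqToHom h) := by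
  subst h
  simpa using hu

lemma rperf_rid (A : Rep.{0} ℤ G) : RPerf (ρ_ A).inv :=
  perf_rid (k := ℤ) (A := A.V)

lemma rperf_step {P A B C D : Rep.{0} ℤ G} (u : P ⟶ A ⊗ B) (hu : RPerf u) (v : A ⟶ C ⊗ D)
    (hv : RPerf v) : RPerf (u ≫ (v ▷ B) ≫ (α_ C D B).hom) :=
  perf_step (k := ℤ) (P := P.V) (A := A.V) (B := B.V) (C := C.V) (D := D.V) _ hu _ hv

lemma rperf_base (P : Rep.{0} ℤ G) {B D : Rep.{0} ℤ G} (w : 𝟙_ (Rep.{0} ℤ G) ⟶ B ⊗ D)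
    (e : B.V ⊗[ℤ] D.V) (he : w.hom.toLinearMap = LinearMap.toSpanSingleton ℤ _ e)
    (hw : ∀ (M : Type) [AddCommGroup M] [Module ℤ M],
      Function.Bijective (fun f : B.V →ₗ[ℤ] M => f.rTensor D.V e)) :
    RPerf ((ρ_ P).inv ≫ (P ◁ w) ≫ (α_ P B D).inv) := by
  have h := perf_base (k := ℤ) (P := P.V) (B := B.V) (D := D.V) e hw
  rw [← he] at h
  exact h

variable [Fintype G]

variable (G) in
lemma preElt_eq : preElt G = ∑ r, (Module.Free.chooseBasis ℤ (IGcar G)).dualBasis r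
    ⊗ₜ[ℤ] (Module.Free.chooseBasis ℤ (IGcar G)) r := by
  classical
  unfold preElt
  rw [LinearEquiv.symm_apply_eq]
  apply (Module.Free.chooseBasis ℤ (IGcar G)).ext
  intro j
  rw [map_sum, LinearMap.sum_apply]
  rw [Finset.sum_eq_single j]
  · simp [dualTensorHomEquiv]
  · intro r _ hr
    simp [dualTensorHomEquiv, hr.symm]
  · simp

lemma coev_bij (M : Type) [AddCommGroup M] [Module ℤ M] :
    Function.Bijective (fun f : (IGrep G).V →ₗ[ℤ] M => f.rTensor (DIG G).V (coevElt G)) := by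
  classical
  have h : coevElt G = ∑ r, (Module.Free.chooseBasis ℤ (IGcar G)) r
      ⊗ₜ[ℤ] (Module.Free.chooseBasis ℤ (IGcar G)).dualBasis r := by
    unfold coevElt
    refine (congrArg (TensorProduct.comm ℤ (Module.Dual ℤ (IGcar G)) (IGcar G))
      (preElt_eq G)).trans ?_
    rw [map_sum]
    rfl
  rw [h]
  exact elt_bij (k := ℤ) (Module.Free.chooseBasis ℤ (IGcar G))
    (Module.Free.chooseBasis ℤ (IGcar G)).dualBasis M

lemma coev_bij' (M : Type) [AddCommGroup M] [Module ℤ M] :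
    Function.Bijective (fun f : (DIG G).V →ₗ[ℤ] M => f.rTensor (IGrep G).V (preElt G)) := by
  classical
  rw [preElt_eq]
  exact elt_bij (k := ℤ) (Module.Free.chooseBasis ℤ (IGcar G)).dualBasis
    (Module.Free.chooseBasis ℤ (IGcar G)) M

lemma coev_braid : (coev G ≫ (β_ (IGrep G) (DIG G)).hom).hom.toLinearMap
    = LinearMap.toSpanSingleton ℤ _ (preElt G) := by
  apply LinearMap.ext_ring
  show (TensorProduct.comm ℤ (IGrep G).V (DIG G).V) ((1 : ℤ) • coevElt G) = (1 : ℤ) • preElt G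
  rw [one_smul, one_smul]
  exact (TensorProduct.comm ℤ (DIG G).V (IGrep G).V).symm_apply_apply (preElt G)

lemma rperf_tMap (n : ℤ) (hn : 0 < n) : RPerf (tMap (G := G) n) := by
  match n, hn with
  | .ofNat (m + 1), _ =>
    exact rperf_eqToHom _ _ (rperf_base (Jp G m) (coev G) (coevElt G) rfl
      (fun M _ _ => coev_bij M))

lemma rperf_sMap (n : ℤ) (hn : n < 0) : RPerf (sMap (G := G) n) := by
  match n, hn with
  | .negSucc 0, _ =>
    have h := rperf_base (𝟙_ (Rep ℤ G)) (B := DIG G) (D := IGrep G) _ (preElt G) (coev_braid (G := G))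
      (fun M _ _ => coev_bij' M)
    have e : (ρ_ (𝟙_ (Rep ℤ G))).inv ≫ (𝟙_ (Rep ℤ G) ◁ (coev G ≫ (β_ (IGrep G) (DIG G)).hom))
        ≫ (α_ (𝟙_ (Rep ℤ G)) (DIG G) (IGrep G)).inv
        = coev G ≫ (β_ (IGrep G) (DIG G)).hom ≫ ((λ_ (DIG G)).inv ▷ IGrep G) := by
      monoidal
    rw [e] at h
    exact h
  | .negSucc (m + 1), _ =>
    exact rperf_base (Jn G (m + 1)) (B := DIG G) (D := IGrep G) _ (preElt G) (coev_braid (G := G))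
      (fun M _ _ => coev_bij' M)

lemma rperf_μpos (i : ℤ) (m : ℕ) (h : i + m ≤ 0) : RPerf (μpos (G := G) i m) := by
  induction m with
  | zero => exact rperf_eqToHom _ _ (rperf_rid _)
  | succ m ih =>
    have h1 := ih (by push_cast at h; omega)
    have h2 := rperf_sMap (G := G) (i + m) (by push_cast at h; omega)
    exact rperf_eqToHom _ _ (rperf_step _ h2 _ h1)

lemma rperf_μneg (i : ℤ) (m : ℕ) (h : 0 ≤ i - m) : RPerf (μneg (G := G) i m) := by
  induction m with
  | zero => exact rperf_eqToHom _ _ (rperf_rid _)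
  | succ m ih =>
    have h1 := ih (by push_cast at h; omega)
    have h2 := rperf_tMap (G := G) (i - m) (by push_cast at h; omega)
    have h3 := rperf_whisker (show J G (-(m:ℤ)) ⊗ DIG G = J G (-((m:ℕ)+1:ℕ)) by
            rw [J_neg, J_neg]; rfl) _ (rperf_step _ h2 _ h1)
    simp only [Category.assoc] at h3
    exact rperf_eqToHom _ _ h3

lemma rperf_μ (i j : ℤ) (h : i + j = 0) : RPerf (μ G i j) := by
  match j, h with
  | .ofNat m, h => exact rperf_μpos i m h.le
  | .negSucc m, h =>
    exact rperf_eqToHom _ _ (rperf_μneg i (m + 1) (by rw [Int.negSucc_eq] at h; push_cast; omega))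

lemma tensor_ff {k A B : Type} [CommRing k] [AddCommGroup A] [Module k A] [AddCommGroup B]
    [Module k B] (hA : Module.Finite k A ∧ Module.Free k A)
    (hB : Module.Finite k B ∧ Module.Free k B) :
    Module.Finite k (A ⊗[k] B) ∧ Module.Free k (A ⊗[k] B) := by
  obtain ⟨_, _⟩ := hA
  obtain ⟨_, _⟩ := hB
  exact ⟨inferInstance, inferInstance⟩

lemma Jp_ff (m : ℕ) : Module.Finite ℤ (Jp G m).V ∧ Module.Free ℤ (Jp G m).V := by
  induction m with
  | zero => exact ⟨inferInstanceAs (Module.Finite ℤ ℤ), inferInstanceAs (Module.Free ℤ ℤ)⟩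
  | succ m ih =>
    exact tensor_ff (k := ℤ) (A := (Jp G m).V) (B := IGcar G) ih ⟨inferInstance, inferInstance⟩

lemma Jn_ff (m : ℕ) : Module.Finite ℤ (Jn G m).V ∧ Module.Free ℤ (Jn G m).V := by
  induction m with
  | zero => exact ⟨inferInstanceAs (Module.Finite ℤ ℤ), inferInstanceAs (Module.Free ℤ ℤ)⟩
  | succ m ih =>
    exact tensor_ff (k := ℤ) (A := (Jn G m).V) (B := Module.Dual ℤ (IGcar G)) ih ⟨inferInstance, inferInstance⟩

lemma J_ff (n : ℤ) : Module.Finite ℤ (J G n).V ∧ Module.Free ℤ (J G n).V := by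
  match n with
  | .ofNat m => exact Jp_ff m
  | .negSucc m => exact Jn_ff (m + 1)

end RPerf

end Enc


namespace Enc

section AbstractDuality

variable {G : Type} [Group G] [Fintype G] {Y W : Type} [AddCommGroup Y] [Module ℤ Y]
  [AddCommGroup W] [Module ℤ W] (ρ : Representation ℤ G Y) (σ : Representation ℤ G W)

lemma dual_inj (hY : Module.Free ℤ Y) (Φ : W →ₗ[ℤ] (Y →ₗ[ℤ] ℤ)) (hΦ : Function.Bijective Φ)
    (heq : ∀ g w y, Φ (σ g w) (ρ g y) = Φ w y) (w : W) (hw : w ∈ σ.invariants)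
    (hd : ∀ y ∈ ρ.invariants, (Fintype.card G : ℤ) ∣ Φ w y) : ∃ w', rnorm σ w' = w := by
  obtain ⟨φ, hφ⟩ := core_inj ρ (Φ w) (fun g y => by
    conv_lhs => rw [← hw g]
    exact heq g w y) hd
  obtain ⟨w', rfl⟩ := hΦ.2 φ
  refine ⟨w', hΦ.1 ?_⟩
  ext y
  rw [← hφ y]
  simp only [rnorm, LinearMap.sum_apply, map_sum]
  refine Fintype.sum_equiv (Equiv.inv G) _ _ (fun g => ?_)
  rw [← heq g w' _]
  simp

lemma dual_surj (hY : Module.Free ℤ Y) (Φ : W →ₗ[ℤ] (Y →ₗ[ℤ] ℤ)) (hΦ : Function.Bijective Φ)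
    (heq : ∀ g w y, Φ (σ g w) (ρ g y) = Φ w y) (h : ρ.invariants →+ ZMod (Fintype.card G))
    (hh : ∀ y, h (rnormRes ρ y) = 0) :
    ∃ w ∈ σ.invariants, ∀ y : ρ.invariants,
      ((Φ w y.1 : ℤ) : ZMod (Fintype.card G)) = h y := by
  obtain ⟨F, hF1, hF2⟩ := core_surj ρ h hh
  obtain ⟨w, rfl⟩ := hΦ.2 F
  refine ⟨w, fun g => hΦ.1 ?_, hF2⟩
  ext y
  have := heq g w (ρ g⁻¹ y)
  rw [hF1] at this
  simpa using this

end AbstractDuality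

lemma lin2_add {k W Y : Type} [CommRing k] [AddCommGroup W] [Module k W] [AddCommGroup Y]
    [Module k Y] (Φ : W →ₗ[k] (Y →ₗ[k] k)) (f f' : W) (y : Y) :
    Φ (f + f') y = Φ f y + Φ f' y := by
  rw [map_add, LinearMap.add_apply]

lemma lin2_sub {k W Y : Type} [CommRing k] [AddCommGroup W] [Module k W] [AddCommGroup Y]
    [Module k Y] (Φ : W →ₗ[k] (Y →ₗ[k] k)) (f f' : W) (y : Y) :
    Φ (f - f') y = Φ f y - Φ f' y := by
  rw [map_sub, LinearMap.sub_apply]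

lemma dvd_of_cast_eq {n : ℕ} {a b c : ℤ} (h : c = a - b) (hab : (a : ZMod n) = (b : ZMod n)) :
    (n : ℤ) ∣ c := by
  rw [h, ← ZMod.intCast_zmod_eq_zero_iff_dvd, Int.cast_sub]
  exact sub_eq_zero.mpr hab

section Phi

variable {k A X L : Type} [CommRing k] [AddCommGroup A] [Module k A] [AddCommGroup X]
  [Module k X] [AddCommGroup L] [Module k L]

/-- The map `α ⊗ l ↦ (y ↦ α (y l))`. -/
noncomputable def Tmap : (X →ₗ[k] k) ⊗[k] L →ₗ[k] ((L →ₗ[k] X) →ₗ[k] k) :=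
  TensorProduct.lift (LinearMap.mk₂ k (fun α l => α ∘ₗ (LinearMap.applyₗ l))
    (fun _ _ _ => by ext; simp) (fun _ _ _ => by ext; simp)
    (fun _ _ _ => by ext; simp) (fun _ _ _ => by ext; simp))

lemma Tmap_tmul (α : X →ₗ[k] k) (l : L) (y : L →ₗ[k] X) : Tmap (α ⊗ₜ[k] l) y = α (y l) := rfl

/-- The pairing between `Hom(A, Hom(X, k))` and `Hom(L, X)` defined by an element of `A ⊗ L`. -/
noncomputable def Phi (c : A ⊗[k] L) : (A →ₗ[k] (X →ₗ[k] k)) →ₗ[k] ((L →ₗ[k] X) →ₗ[k] k) :=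
  Tmap ∘ₗ (LinearMap.applyₗ c) ∘ₗ (LinearMap.rTensorHom L)

lemma Phi_apply (c : A ⊗[k] L) (f : A →ₗ[k] (X →ₗ[k] k)) : Phi c f = Tmap (f.rTensor L c) := rfl

lemma Phi_zero (f : A →ₗ[k] (X →ₗ[k] k)) (y : L →ₗ[k] X) : Phi 0 f y = 0 := by
  simp [Phi_apply]

lemma Phi_add (c c' : A ⊗[k] L) (f : A →ₗ[k] (X →ₗ[k] k)) (y : L →ₗ[k] X) :
    Phi (c + c') f y = Phi c f y + Phi c' f y := by
  simp [Phi_apply]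

lemma Phi_fadd (c : A ⊗[k] L) (f f' : A →ₗ[k] (X →ₗ[k] k)) (y : L →ₗ[k] X) :
    Phi c (f + f') y = Phi c f y + Phi c f' y := by
  rw [map_add, LinearMap.add_apply]

lemma Phi_fsub (c : A ⊗[k] L) (f f' : A →ₗ[k] (X →ₗ[k] k)) (y : L →ₗ[k] X) :
    Phi c (f - f') y = Phi c f y - Phi c f' y := by
  have h := Phi_fadd c (f - f') f' y
  have e : f - f' + f' = f := LinearMap.ext (fun a => LinearMap.ext (fun x =>
    show f a x - f' a x + f' a x = f a x from sub_add_cancel _ _))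
  rw [e] at h
  exact eq_sub_of_add_eq h.symm

lemma Phi_map (c : A ⊗[k] L) (f f' : A →ₗ[k] (X →ₗ[k] k)) (y y' : L →ₗ[k] X)
    (a : A →ₗ[k] A) (b : L →ₗ[k] L)
    (hab : ∀ u v, f' u (y' v) = f (a u) (y (b v))) :
    Phi c f' y' = Phi (TensorProduct.map a b c) f y := by
  simp only [Phi_apply]
  induction c with
  | zero => simp
  | tmul u v => simp [Tmap_tmul, hab]
  | add u v hu hv => simp only [map_add, LinearMap.add_apply, hu, hv]

lemma Phi_bij {P : Type} [AddCommGroup P] [Module k P] (u : P →ₗ[k] A ⊗[k] L) (hu : Perf u)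
    (e : P) (he : Function.Bijective (LinearMap.toSpanSingleton k P e))
    [Module.Finite k L] [Module.Free k L] :
    Function.Bijective (Phi (X := X) (u e)) := by
  cases subsingleton_or_nontrivial k
  · have : Subsingleton ((L →ₗ[k] X) →ₗ[k] k) := Module.subsingleton k _
    have : Subsingleton (A →ₗ[k] (X →ₗ[k] k)) := Module.subsingleton k _
    exact ⟨fun _ _ _ => Subsingleton.elim _ _, fun _ => ⟨0, Subsingleton.elim _ _⟩⟩
  have hT : Function.Bijective (Tmap (k := k) (X := X) (L := L)) :=
    final_bij (Module.Free.chooseBasis k L) _ Tmap_tmul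
  have hev : Function.Bijective (fun q : P →ₗ[k] ((X →ₗ[k] k) ⊗[k] L) => q e) := by
    let E := LinearEquiv.ofBijective _ he
    have hE : ∀ a, E a = a • e := fun a => rfl
    constructor
    · intro q q' hq
      ext p
      obtain ⟨a, rfl⟩ := E.surjective p
      simp only at hq
      rw [hE, map_smul, map_smul, hq]
    · intro z
      refine ⟨LinearMap.toSpanSingleton k _ z ∘ₗ E.symm.toLinearMap, ?_⟩
      have : E.symm e = 1 := by rw [LinearEquiv.symm_apply_eq, hE, one_smul]
      simp [this]
  exact hT.comp (hev.comp (hu (X →ₗ[k] k)))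

lemma free_hom [Module.Finite k L] [Module.Free k L] [Module.Free k X] :
    Module.Free k (L →ₗ[k] X) := by
  cases subsingleton_or_nontrivial k
  · have : Subsingleton (L →ₗ[k] X) := Module.subsingleton k _
    infer_instance
  exact Module.Free.of_equiv ((Module.Free.chooseBasis k L).constr k (M' := X))

end Phi

section Final

variable {G : Type} [Group G] [Fintype G]

lemma tate_ind {n : ℤ} {M : Rep ℤ G} (z : tate n M) :
    ∃ f : (hRep (J G n) M).ρ.invariants, z = tate0mk f.1 f.2 := by
  obtain ⟨f, hf⟩ := Submodule.Quotient.mk_surjective (rnormIm (hRep (J G n) M).ρ) z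
  exact ⟨f, hf.symm⟩

lemma tcast_add {i j : ℤ} {M : Rep ℤ G} (h : i = j) (a b : tate i M) :
    tcast h (a + b) = tcast h a + tcast h b := by
  subst h
  rfl

lemma tcast_tcast {i j : ℤ} {M : Rep ℤ G} (h : i = j) (a : tate j M) :
    tcast h (tcast h.symm a) = a := by
  subst h
  rfl

lemma tcast_zero {i j : ℤ} {M : Rep ℤ G} (h : i = j) :
    tcast h (0 : tate i M) = 0 := by
  subst h
  rfl

lemma rnorm_of_trivial {V : Type} [AddCommGroup V] [Module ℤ V] (r : Representation ℤ G V)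
    (ψ : V) (h : ∀ g, r g ψ = ψ) : rnorm r ψ = (Fintype.card G : ℤ) • ψ := by
  simp only [rnorm, LinearMap.sum_apply, h]
  simp

lemma exists_eps_aux {V : Type} [AddCommGroup V] [Module ℤ V] (r : Representation ℤ G V)
    (ev0 : V →ₗ[ℤ] ℤ) (hr : ∀ ψ, ev0 (rnorm r ψ) = Fintype.card G * ev0 ψ)
    (hinj : ∀ f ∈ r.invariants, (Fintype.card G : ℤ) ∣ ev0 f → ∃ ψ, rnorm r ψ = f) :
    ∃ eps : tate0 r →+ ZMod (Fintype.card G), Function.Injective eps ∧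
      ∀ v hv, eps (tate0mk v hv) = ((ev0 v : ℤ) : ZMod (Fintype.card G)) := by
  let ev : r.invariants →+ ZMod (Fintype.card G) :=
    { toFun := fun φ => ((ev0 φ.1 : ℤ) : ZMod _)
      map_zero' := by simp
      map_add' := fun a b => by simp }
  have hev : ∀ φ : r.invariants, ev φ = ((ev0 φ.1 : ℤ) : ZMod _) := fun _ => rfl
  have hk : rnormIm r ≤ LinearMap.ker (toLin ev) := by
    rintro _ ⟨ψ, rfl⟩
    rw [LinearMap.mem_ker, toLin_apply, hev]
    refine (congrArg (fun t : ℤ => (t : ZMod (Fintype.card G))) (hr ψ)).trans ?_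
    simp
  refine ⟨((rnormIm r).liftQ (toLin ev) hk).toAddMonoidHom, ?_, fun φ hφ => rfl⟩
  refine (injective_iff_map_eq_zero ((rnormIm r).liftQ (toLin ev) hk).toAddMonoidHom).mpr ?_
  intro z hz
  obtain ⟨f, rfl⟩ := Submodule.Quotient.mk_surjective (rnormIm r) z
  have h1 : ((ev0 f.1 : ℤ) : ZMod (Fintype.card G)) = 0 := hz
  rw [ZMod.intCast_zmod_eq_zero_iff_dvd] at h1
  obtain ⟨ψ, hψ⟩ := hinj f.1 f.2 h1
  exact (Submodule.Quotient.mk_eq_zero (rnormIm r)).mpr ⟨ψ, Subtype.ext hψ⟩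

lemma exists_eps (j : ℤ) (h : j = 0) :
    ∃ (e : (J G j).V) (eps : tate j (Rep.trivial ℤ G ℤ) →+ ZMod (Fintype.card G)),
      (∀ g, (J G j).ρ g e = e) ∧ Function.Bijective (LinearMap.toSpanSingleton ℤ _ e) ∧
      Function.Injective eps ∧
      ∀ (φ : (J G j).V →ₗ[ℤ] ℤ) (hφ : φ ∈ (hRep (J G j) (Rep.trivial ℤ G ℤ)).ρ.invariants),
        eps (tate0mk (ρ := (hRep (J G j) (Rep.trivial ℤ G ℤ)).ρ) φ hφ) = ((φ e : ℤ) : ZMod _) := by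
  subst h
  let o : (J G 0).V := (1 : ℤ)
  let ev0 : ((J G 0).V →ₗ[ℤ] ℤ) →ₗ[ℤ] ℤ := LinearMap.applyₗ o
  let r : Representation ℤ G ((J G 0).V →ₗ[ℤ] ℤ) := (hRep (J G 0) (Rep.trivial ℤ G ℤ)).ρ
  have hn : ∀ ψ, rnorm r ψ = (Fintype.card G : ℤ) • ψ := fun ψ =>
    rnorm_of_trivial r ψ (fun g => rfl)
  obtain ⟨eps, h1, h2⟩ := exists_eps_aux r ev0
    (fun ψ => (congrArg ev0 (hn ψ)).trans (by rw [map_smul, smul_eq_mul]))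
    (fun f _ hd => by
      obtain ⟨c, hc⟩ := hd
      refine ⟨(LinearMap.toSpanSingleton ℤ ℤ c : ℤ →ₗ[ℤ] ℤ), (hn _).trans ?_⟩
      have : ∀ F F' : ℤ →ₗ[ℤ] ℤ, F 1 = F' 1 → F = F' := fun F F' h => LinearMap.ext_ring h
      refine this _ _ ?_
      refine Eq.trans ?_ hc.symm
      show (Fintype.card G : ℤ) * (1 * c) = _
      rw [one_mul])
  refine ⟨o, eps, fun g => rfl, ?_, h1, fun φ hφ => h2 φ hφ⟩
  constructor
  · intro a b hab
    have : a * 1 = b * 1 := hab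
    simpa using this
  · intro a
    exact ⟨(show ℤ from a), mul_one (show ℤ from a)⟩

/-- Explicit form of the pairing on cochains. -/
lemma pairing_formula {i j : ℤ} {X : Rep ℤ G} (e : (J G (i + j)).V)
    (f : (hRep (J G i) (hRep X (Rep.trivial ℤ G ℤ))).ρ.invariants)
    (y : (hRep (J G j) X).ρ.invariants) :
    ∃ (φ : (J G (i + j)).V →ₗ[ℤ] ℤ)
      (hφ : φ ∈ (hRep (J G (i + j)) (Rep.trivial ℤ G ℤ)).ρ.invariants),
      tmap (i + j) (evPair X (Rep.trivial ℤ G ℤ))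
        (cup (tate0mk f.1 f.2 : tate i (hRep X (Rep.trivial ℤ G ℤ))) (tate0mk y.1 y.2 : tate j X))
        = tate0mk (ρ := (hRep (J G (i + j)) (Rep.trivial ℤ G ℤ)).ρ) φ hφ ∧
      φ e = Phi (k := ℤ) (A := (J G i).V) (X := X.V) (L := (J G j).V)
        ((μ G i j).hom.toLinearMap e) f.1 y.1 := by
  refine ⟨(evPair X (Rep.trivial ℤ G ℤ)).hom.toLinearMap ∘ₗ
    ((TensorProduct.map f.1 y.1).comp ((μ G i j).hom.toLinearMap)), ?_, rfl, ?_⟩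
  · exact invariants_comp (ρ := (hRep (J G (i + j)) (hRep X (Rep.trivial ℤ G ℤ) ⊗ X)).ρ)
      ((Rep.ihom (J G (i + j))).map (evPair X (Rep.trivial ℤ G ℤ))).hom.toLinearMap
      (fun g v => Rep.hom_comm_apply _ g v) _ (cup_invariance f y)
  · have key : ∀ z : (J G i).V ⊗[ℤ] (J G j).V,
        (evPair X (Rep.trivial ℤ G ℤ)).hom.toLinearMap (TensorProduct.map f.1 y.1 z)
        = Phi (k := ℤ) (A := (J G i).V) (X := X.V) (L := (J G j).V) z f.1 y.1 := by
      intro z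
      induction z with
      | zero =>
        rw [map_zero]
        refine (map_zero _).trans ?_
        exact (Phi_zero _ _).symm
      | tmul a b => rfl
      | add a b ha hb =>
        rw [map_add]
        refine (map_add _ _ _).trans ?_
        refine (congrArg₂ _ ha hb).trans ?_
        exact (Phi_add _ _ _ _).symm
    exact key _

lemma Phi_equivariant {i j : ℤ} {X : Rep ℤ G} (e : (J G (i + j)).V)
    (he : ∀ g, (J G (i + j)).ρ g e = e) (g : G)
    (f : (J G i).V →ₗ[ℤ] (X.V →ₗ[ℤ] ℤ)) (y : (J G j).V →ₗ[ℤ] X.V) :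
    Phi (k := ℤ) (A := (J G i).V) (X := X.V) (L := (J G j).V) ((μ G i j).hom.toLinearMap e)
      ((hRep (J G i) (hRep X (Rep.trivial ℤ G ℤ))).ρ g f) ((hRep (J G j) X).ρ g y)
    = Phi (k := ℤ) (A := (J G i).V) (X := X.V) (L := (J G j).V)
      ((μ G i j).hom.toLinearMap e) f y := by
  have hc : TensorProduct.map ((J G i).ρ g⁻¹) ((J G j).ρ g⁻¹) ((μ G i j).hom.toLinearMap e)
      = (μ G i j).hom.toLinearMap e := by
    have h := LinearMap.congr_fun ((μ G i j).hom.isIntertwining' g⁻¹) e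
    refine h.symm.trans ?_
    exact congrArg _ (he g⁻¹)
  refine (Phi_map _ f _ y _ ((J G i).ρ g⁻¹) ((J G j).ρ g⁻¹) ?_).trans ?_
  · intro u v
    show f ((J G i).ρ g⁻¹ u) (X.ρ g⁻¹ (X.ρ g (y ((J G j).ρ g⁻¹ v)))) = _
    rw [Representation.inv_self_apply]
  · rw [hc]

end Final

end Enc

open CategoryTheory MonoidalCategory Enc

theorem statement18 (G : Type) [Group G] [Fintype G] (X : Rep ℤ G)
    (hX : Module.Free ℤ X.V) (i : ℤ) :
    (∀ (x : tate i (hRep X (Rep.trivial ℤ G ℤ))) (m₁ m₂ : tate (-i) X),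
        tcast (add_neg_cancel i) (tmap (i + -i) (evPair X (Rep.trivial ℤ G ℤ)) (cup x (m₁ + m₂))) =
          tcast (add_neg_cancel i) (tmap (i + -i) (evPair X (Rep.trivial ℤ G ℤ)) (cup x m₁)) +
          tcast (add_neg_cancel i) (tmap (i + -i) (evPair X (Rep.trivial ℤ G ℤ)) (cup x m₂))) ∧
    (∀ (x₁ x₂ : tate i (hRep X (Rep.trivial ℤ G ℤ))) (m : tate (-i) X),
        tcast (add_neg_cancel i) (tmap (i + -i) (evPair X (Rep.trivial ℤ G ℤ)) (cup (x₁ + x₂) m)) =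
          tcast (add_neg_cancel i) (tmap (i + -i) (evPair X (Rep.trivial ℤ G ℤ)) (cup x₁ m)) +
          tcast (add_neg_cancel i) (tmap (i + -i) (evPair X (Rep.trivial ℤ G ℤ)) (cup x₂ m))) ∧
    (∀ x₁ x₂ : tate i (hRep X (Rep.trivial ℤ G ℤ)),
        (∀ m : tate (-i) X,
            tmap (i + -i) (evPair X (Rep.trivial ℤ G ℤ)) (cup x₁ m) =
              tmap (i + -i) (evPair X (Rep.trivial ℤ G ℤ)) (cup x₂ m)) → x₁ = x₂) ∧
    (∀ h : tate (-i) X →+ tate 0 (Rep.trivial ℤ G ℤ),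
        ∃ x : tate i (hRep X (Rep.trivial ℤ G ℤ)), ∀ m : tate (-i) X,
          h m = tcast (add_neg_cancel i)
            (tmap (i + -i) (evPair X (Rep.trivial ℤ G ℤ)) (cup x m))) := by
  obtain ⟨e, eps, he, hebij, hepsinj, heps⟩ := exists_eps (G := G) (i + -i) (add_neg_cancel i)
  obtain ⟨hfin, hfree⟩ := J_ff (G := G) (-i)
  obtain ⟨Φ, hΦdef⟩ : ∃ Φ, Φ = Phi (k := ℤ) (A := (J G i).V) (X := X.V) (L := (J G (-i)).V)
    ((μ G i (-i)).hom.toLinearMap e) := ⟨_, rfl⟩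
  have hΦ : Function.Bijective Φ := by
    rw [hΦdef]
    exact Phi_bij _ (rperf_μ i (-i) (add_neg_cancel i)) e hebij
  have hY := free_hom (k := ℤ) (L := (J G (-i)).V) (X := X.V)
  have hadd : ∀ f f' y, Φ (f + f') y = Φ f y + Φ f' y := by
    rw [hΦdef]
    exact Phi_fadd _
  have hsub : ∀ f f' y, Φ (f - f') y = Φ f y - Φ f' y := by
    rw [hΦdef]
    exact Phi_fsub _
  have heq : ∀ g f y, Φ ((hRep (J G i) (hRep X (Rep.trivial ℤ G ℤ))).ρ g f)
      ((hRep (J G (-i)) X).ρ g y) = Φ f y := by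
    intro g f y
    rw [hΦdef]
    exact Phi_equivariant e he g f y
  have formula : ∀ (f : (hRep (J G i) (hRep X (Rep.trivial ℤ G ℤ))).ρ.invariants)
      (y : (hRep (J G (-i)) X).ρ.invariants),
      eps (tmap (i + -i) (evPair X (Rep.trivial ℤ G ℤ))
        (cup (tate0mk f.1 f.2 : tate i (hRep X (Rep.trivial ℤ G ℤ)))
          (tate0mk y.1 y.2 : tate (-i) X)))
      = ((Φ f.1 y.1 : ℤ) : ZMod (Fintype.card G)) := by
    intro f y
    obtain ⟨φ, hφ, h1, h2⟩ := pairing_formula e f y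
    rw [h1, hΦdef]
    refine (heps φ hφ).trans ?_
    exact congrArg (fun t : ℤ => (t : ZMod (Fintype.card G))) h2
  refine ⟨?_, ?_, ?_, ?_⟩
  · intro x m₁ m₂
    rw [← tcast_add]
    congr 1
    apply hepsinj
    obtain ⟨f, rfl⟩ := tate_ind x
    obtain ⟨y₁, rfl⟩ := tate_ind m₁
    obtain ⟨y₂, rfl⟩ := tate_ind m₂
    refine (formula f (y₁ + y₂)).trans ?_
    rw [map_add, formula, formula]
    refine (congrArg (fun t : ℤ => (t : ZMod (Fintype.card G)))
      (map_add (Φ f.1) y₁.1 y₂.1)).trans ?_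
    exact Int.cast_add _ _
  · intro x₁ x₂ m
    rw [← tcast_add]
    congr 1
    apply hepsinj
    obtain ⟨f₁, rfl⟩ := tate_ind x₁
    obtain ⟨f₂, rfl⟩ := tate_ind x₂
    obtain ⟨y, rfl⟩ := tate_ind m
    refine (formula (f₁ + f₂) y).trans ?_
    rw [map_add, formula, formula]
    refine (congrArg (fun t : ℤ => (t : ZMod (Fintype.card G)))
      (hadd f₁.1 f₂.1 y.1)).trans ?_
    exact Int.cast_add _ _
  · intro x₁ x₂ hx
    obtain ⟨f₁, rfl⟩ := tate_ind x₁
    obtain ⟨f₂, rfl⟩ := tate_ind x₂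
    obtain ⟨w, hw⟩ := dual_inj (hRep (J G (-i)) X).ρ
      (hRep (J G i) (hRep X (Rep.trivial ℤ G ℤ))).ρ hY Φ hΦ heq (f₁ - f₂).1 (f₁ - f₂).2
      (fun y hy => by
        have h1 := congrArg eps (hx (tate0mk y hy))
        have h2 := (formula f₁ ⟨y, hy⟩).symm.trans (h1.trans (formula f₂ ⟨y, hy⟩))
        have h3 : Φ (f₁ - f₂).1 y = Φ f₁.1 y - Φ f₂.1 y := hsub f₁.1 f₂.1 y
        exact dvd_of_cast_eq h3 h2)
    exact (Submodule.Quotient.eq (rnormIm _)).mpr ⟨w, Subtype.ext hw⟩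
  · intro h
    obtain ⟨w, hw, hwy⟩ := dual_surj (hRep (J G (-i)) X).ρ
      (hRep (J G i) (hRep X (Rep.trivial ℤ G ℤ))).ρ hY Φ hΦ heq
      (AddMonoidHom.mk' (fun y => eps (tcast (add_neg_cancel i).symm (h (tate0mk y.1 y.2))))
        (fun a b => by
          have : (tate0mk (a + b).1 (a + b).2 : tate (-i) X)
            = (tate0mk a.1 a.2 : tate (-i) X) + (tate0mk b.1 b.2 : tate (-i) X) := rfl
          refine (congrArg (fun t => eps (tcast (add_neg_cancel i).symm t))
            ((congrArg h this).trans (map_add h _ _))).trans ?_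
          exact (congrArg eps (tcast_add _ _ _)).trans (map_add eps _ _)))
      (fun y => by
        have h0 : (tate0mk (rnormRes (hRep (J G (-i)) X).ρ y).1
            (rnormRes (hRep (J G (-i)) X).ρ y).2 : tate (-i) X) = 0 :=
          (Submodule.Quotient.mk_eq_zero (rnormIm _)).mpr ⟨y, rfl⟩
        show eps (tcast (add_neg_cancel i).symm (h (tate0mk _ _))) = 0
        refine (congrArg (fun t => eps (tcast (add_neg_cancel i).symm t))
          ((congrArg h h0).trans (map_zero h))).trans ?_
        exact (congrArg eps (tcast_zero _)).trans (map_zero eps))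
    refine ⟨tate0mk w hw, fun m => ?_⟩
    obtain ⟨y, rfl⟩ := tate_ind m
    refine (tcast_tcast (add_neg_cancel i) (h _)).symm.trans ?_
    refine congrArg (tcast (add_neg_cancel i)) (hepsinj ?_)
    exact ((formula ⟨w, hw⟩ y).trans (hwy y)).symm
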